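/- Let V be a monoidal category with projections which is cartesian closed and whose monoidal structure (V, ⊗, I) is biclosed, and suppose V has jointly surjective projections. Then for all objects X, Y, Z of V, the canonical morphism λ : Homₗ(X, Hom(Y, Z)) → Hom(Y, Homₗ(X, Z)) is a monomorphism. -/

import Mathlib

universe v u w w'

open CategoryTheory MonoidalCategory Limits

noncomputable section

namespace PaperComma

variable {V : Type u} [Category.{v} V] [MonoidalCategory V]

/-- A *right closed* structure on a monoidal category `V`: for every object `Y`, the
functor `- ⊗ Y` admits a right adjoint `Homᵣ(Y, -)`. -/
structure RightClosed (V : Type u) [Category.{v} V] [MonoidalCategory V] where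
  homr : V → V ⥤ V
  adj : ∀ Y : V, tensorRight Y ⊣ homr Y

/-- A *left closed* structure on a monoidal category `V`: for every object `X`, the
functor `X ⊗ -` admits a right adjoint `Homₗ(X, -)`. -/
structure LeftClosed (V : Type u) [Category.{v} V] [MonoidalCategory V] where
  homl : V → V ⥤ V
  adj : ∀ X : V, tensorLeft X ⊣ homl X

namespace RightClosed

variable (R : RightClosed V)

/-- `Homᵣ(Y, Z)`. -/
def hr (Y Z : V) : V := (R.homr Y).obj Z

/-- Transposition under the adjunction `- ⊗ Y ⊣ Homᵣ(Y, -)`. -/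
def curry {X Y Z : V} (f : X ⊗ Y ⟶ Z) : X ⟶ R.hr Y Z :=
  ((R.adj Y).homEquiv X Z) f

/-- Inverse transposition. -/
def uncurry {X Y Z : V} (g : X ⟶ R.hr Y Z) : X ⊗ Y ⟶ Z :=
  ((R.adj Y).homEquiv X Z).symm g

/-- The evaluation morphism (counit) `Homᵣ(Y, Z) ⊗ Y ⟶ Z`. -/
def ev (Y Z : V) : R.hr Y Z ⊗ Y ⟶ Z :=
  (R.adj Y).counit.app Z

/-- The identity `I ⟶ Homᵣ(X, X)` of the `V`-category `V_r`. -/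
def idr (X : V) : 𝟙_ V ⟶ R.hr X X :=
  R.curry (λ_ X).hom

/-- The composition `Homᵣ(Y, Z) ⊗ Homᵣ(X, Y) ⟶ Homᵣ(X, Z)` of the `V`-category `V_r`. -/
def compr (X Y Z : V) : R.hr Y Z ⊗ R.hr X Y ⟶ R.hr X Z :=
  R.curry ((α_ (R.hr Y Z) (R.hr X Y) X).hom ≫ (R.hr Y Z ◁ R.ev X Y) ≫ R.ev Y Z)

/-- Contravariant action of `Homᵣ` in its first variable. -/
def pre {Y' Y : V} (f : Y' ⟶ Y) (Z : V) : R.hr Y Z ⟶ R.hr Y' Z :=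
  R.curry ((R.hr Y Z ◁ f) ≫ R.ev Y Z)

end RightClosed

namespace LeftClosed

variable (L : LeftClosed V)

/-- `Homₗ(X, Z)`. -/
def hl (X Z : V) : V := (L.homl X).obj Z

/-- Transposition under the adjunction `X ⊗ - ⊣ Homₗ(X, -)`. -/
def curry {X A B : V} (f : X ⊗ A ⟶ B) : A ⟶ L.hl X B :=
  ((L.adj X).homEquiv A B) f

/-- Inverse transposition. -/
def uncurry {X A B : V} (g : A ⟶ L.hl X B) : X ⊗ A ⟶ B :=
  ((L.adj X).homEquiv A B).symm g

/-- The evaluation morphism (counit) `X ⊗ Homₗ(X, Z) ⟶ Z`. -/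
def ev (X Z : V) : X ⊗ L.hl X Z ⟶ Z :=
  (L.adj X).counit.app Z

/-- The identity `I ⟶ Homₗ(X, X)` of the anti `V`-category `V_l`. -/
def idl (X : V) : 𝟙_ V ⟶ L.hl X X :=
  L.curry (ρ_ X).hom

/-- The composition `Homₗ(X, Y) ⊗ Homₗ(Y, Z) ⟶ Homₗ(X, Z)` of the anti `V`-category `V_l`. -/
def compl (X Y Z : V) : L.hl X Y ⊗ L.hl Y Z ⟶ L.hl X Z :=
  L.curry ((α_ X (L.hl X Y) (L.hl Y Z)).inv ≫ (L.ev X Y ▷ L.hl Y Z) ≫ L.ev Y Z)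

/-- Contravariant action of `Homₗ` in its first variable. -/
def pre {X' X : V} (g : X' ⟶ X) (Z : V) : L.hl X Z ⟶ L.hl X' Z :=
  L.curry ((g ▷ L.hl X Z) ≫ L.ev X Z)

end LeftClosed

section Projections

variable (hI : IsTerminal (𝟙_ V))

/-- The first projection `X ⊗ Y ⟶ X`, when the monoidal unit is terminal. -/
def pi1 (X Y : V) : X ⊗ Y ⟶ X := (X ◁ hI.from Y) ≫ (ρ_ X).hom

/-- The second projection `X ⊗ Y ⟶ Y`, when the monoidal unit is terminal. -/
def pi2 (X Y : V) : X ⊗ Y ⟶ Y := (hI.from X ▷ Y) ≫ (λ_ Y).hom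

/-- The canonical morphism `π = (π₁, π₂) : X ⊗ Y ⟶ X ⨯ Y`. -/
def piMap [HasBinaryProducts V] (X Y : V) : X ⊗ Y ⟶ X ⨯ Y :=
  prod.lift (pi1 hI X Y) (pi2 hI X Y)

end Projections

end PaperComma


namespace PaperComma

variable {V : Type u} [Category.{v} V] [MonoidalCategory V]

/-- A cartesian closed structure on `V`: for every object `X`, the functor `- ⨯ X`
admits a right adjoint `Hom(X, -)` (the cartesian internal hom). -/
structure CartClosed (V : Type u) [Category.{v} V] [HasBinaryProducts V] where
  chom : V → V ⥤ V
  adj : ∀ X : V, prod.functor.flip.obj X ⊣ chom X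

namespace CartClosed

variable [HasBinaryProducts V] (cc : CartClosed V)

/-- The cartesian internal hom `Hom(X, Z)`. -/
def ch (X Z : V) : V := (cc.chom X).obj Z

/-- Transposition under the adjunction `- ⨯ X ⊣ Hom(X, -)`. -/
def curry {W X B : V} (f : W ⨯ X ⟶ B) : W ⟶ cc.ch X B :=
  ((cc.adj X).homEquiv W B) f

/-- Inverse transposition. -/
def uncurry {W X B : V} (g : W ⟶ cc.ch X B) : W ⨯ X ⟶ B :=
  ((cc.adj X).homEquiv W B).symm g

/-- The evaluation morphism `Hom(X, Z) ⨯ X ⟶ Z`. -/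
def ev (X Z : V) : cc.ch X Z ⨯ X ⟶ Z := (cc.adj X).counit.app Z

/-- The identity `I ⟶ Hom(X, X)` of the self-enrichment `V_cart` (with the terminal
unit `I`). -/
def cid (X : V) : 𝟙_ V ⟶ cc.ch X X := cc.curry prod.snd

/-- The composition `Hom(Y, Z) ⨯ Hom(X, Y) ⟶ Hom(X, Z)` of the self-enrichment
`V_cart`. -/
def ccomp (X Y Z : V) : cc.ch Y Z ⨯ cc.ch X Y ⟶ cc.ch X Z :=
  cc.curry ((prod.associator (cc.ch Y Z) (cc.ch X Y) X).hom
    ≫ prod.map (𝟙 (cc.ch Y Z)) (cc.ev X Y) ≫ cc.ev Y Z)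

/-- Contravariant action of the cartesian internal hom in its first variable. -/
def cpre {Y' Y : V} (f : Y' ⟶ Y) (Z : V) : cc.ch Y Z ⟶ cc.ch Y' Z :=
  cc.curry (prod.map (𝟙 (cc.ch Y Z)) f ≫ cc.ev Y Z)

end CartClosed

section Canonical

variable [HasBinaryProducts V] (hI : IsTerminal (𝟙_ V))

/-- The canonical morphism `can_r : Hom(X, Y) ⟶ Homᵣ(X, Y)`, corresponding under the
adjunction `- ⊗ X ⊣ Homᵣ(X, -)` to `Hom(X, Y) ⊗ X --π--> Hom(X, Y) ⨯ X --ev--> Y`. -/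
def canr (R : RightClosed V) (cc : CartClosed V) (X Y : V) : cc.ch X Y ⟶ R.hr X Y :=
  R.curry (piMap hI (cc.ch X Y) X ≫ cc.ev X Y)

/-- The canonical morphism `can_l : Hom(X, Y) ⟶ Homₗ(X, Y)`, corresponding under the
adjunction `X ⊗ - ⊣ Homₗ(X, -)` to
`X ⊗ Hom(X, Y) --π--> X ⨯ Hom(X, Y) ≅ Hom(X, Y) ⨯ X --ev--> Y`. -/
def canl (L : LeftClosed V) (cc : CartClosed V) (X Y : V) : cc.ch X Y ⟶ L.hl X Y :=
  L.curry (piMap hI X (cc.ch X Y) ≫ (prod.braiding X (cc.ch X Y)).hom ≫ cc.ev X Y)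

end Canonical

end PaperComma

namespace PaperComma

variable {V : Type u} [Category.{v} V] [MonoidalCategory V]

section Lam

variable [HasBinaryProducts V] (hI : IsTerminal (𝟙_ V))

/-- The canonical morphism `φ : X ⊗ (Y ⨯ Z) ⟶ (X ⊗ Y) ⨯ Z`, with first component
`X ◁ p₁` and second component `p₂ ∘ π₂`. -/
def phi (X Y Z : V) : X ⊗ (Y ⨯ Z) ⟶ (X ⊗ Y) ⨯ Z :=
  prod.lift (X ◁ prod.fst) (pi2 hI X (Y ⨯ Z) ≫ prod.snd)

/-- The canonical morphism `λ : Homₗ(X, Hom(Y, Z)) ⟶ Hom(Y, Homₗ(X, Z))`, obtained by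
transposing twice the composite
`X ⊗ (Homₗ(X, Hom(Y, Z)) ⨯ Y) --φ--> (X ⊗ Homₗ(X, Hom(Y, Z))) ⨯ Y --ev ⨯ Y--> Hom(Y, Z) ⨯ Y --ev--> Z`. -/
def lam (L : LeftClosed V) (cc : CartClosed V) (X Y Z : V) :
    L.hl X (cc.ch Y Z) ⟶ cc.ch Y (L.hl X Z) :=
  cc.curry (L.curry
    (phi hI X (L.hl X (cc.ch Y Z)) Y
      ≫ prod.map (L.ev X (cc.ch Y Z)) (𝟙 Y) ≫ cc.ev Y Z))

/-- The canonical isomorphism-defining morphism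
`Homₗ(X, Homᵣ(Y, Z)) ⟶ Homᵣ(Y, Homₗ(X, Z))`, corresponding to
`(X ⊗ Homₗ(X, Homᵣ(Y, Z))) ⊗ Y --ev ⊗ Y--> Homᵣ(Y, Z) ⊗ Y --ev--> Z`. -/
def switch (R : RightClosed V) (L : LeftClosed V) (X Y Z : V) :
    L.hl X (R.hr Y Z) ⟶ R.hr Y (L.hl X Z) :=
  R.curry (L.curry
    ((α_ X (L.hl X (R.hr Y Z)) Y).inv ≫ (L.ev X (R.hr Y Z) ▷ Y) ≫ R.ev Y Z))

end Lam

end PaperComma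

namespace PaperComma

variable {V : Type u} [Category.{v} V] [MonoidalCategory V]

theorem pi2_nat (hI : IsTerminal (𝟙_ V)) (X : V) {A B : V} (f : A ⟶ B) :
    (X ◁ f) ≫ pi2 hI X B = pi2 hI X A ≫ f := by
  simp [pi2, whisker_exchange_assoc]

theorem pi1_assoc (hI : IsTerminal (𝟙_ V)) (X W Y : V) :
    (α_ X W Y).hom ≫ (X ◁ pi1 hI W Y) = pi1 hI (X ⊗ W) Y := by
  simp [pi1]

theorem pi2_assoc (hI : IsTerminal (𝟙_ V)) (X W Y : V) :
    (α_ X W Y).hom ≫ pi2 hI X (W ⊗ Y) ≫ pi2 hI W Y = pi2 hI (X ⊗ W) Y := by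
  have h : hI.from (X ⊗ W) = pi2 hI X W ≫ hI.from W := hI.hom_ext _ _
  rw [pi2, pi2, pi2, h, pi2]
  simp [-IsTerminal.comp_from]

theorem phi_pi [HasBinaryProducts V] (hI : IsTerminal (𝟙_ V)) (X W Y : V) :
    (α_ X W Y).hom ≫ (X ◁ piMap hI W Y) ≫ phi hI X W Y = piMap hI (X ⊗ W) Y := by
  apply Limits.prod.hom_ext
  · simp only [phi, Category.assoc, prod.lift_fst, ← whiskerLeft_comp]
    simp only [piMap, prod.lift_fst, pi1_assoc]
  · simp only [phi, Category.assoc, prod.lift_snd]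
    rw [← Category.assoc (X ◁ _), pi2_nat]
    simp only [piMap, Category.assoc, prod.lift_snd, pi2_assoc]

theorem phi_epi [HasBinaryProducts V] (hI : IsTerminal (𝟙_ V))
    (hepi : ∀ X Y : V, Epi (piMap hI X Y)) (X W Y : V) : Epi (phi hI X W Y) := by
  have h := hepi (X ⊗ W) Y
  rw [← phi_pi, ← Category.assoc] at h
  exact epi_of_epi ((α_ X W Y).hom ≫ (X ◁ piMap hI W Y)) _

theorem phi_nat [HasBinaryProducts V] (hI : IsTerminal (𝟙_ V)) (X : V) {W W' : V} (Y : V)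
    (a : W ⟶ W') :
    (X ◁ prod.map a (𝟙 Y)) ≫ phi hI X W' Y = phi hI X W Y ≫ prod.map (X ◁ a) (𝟙 Y) := by
  apply Limits.prod.hom_ext
  · simp only [phi, Category.assoc, prod.lift_fst, ← whiskerLeft_comp, prod.map_fst,
      prod.lift_fst_assoc]
  · simp only [phi, Category.assoc, prod.lift_snd, prod.map_snd, prod.lift_snd_assoc]
    rw [← Category.assoc (X ◁ _), pi2_nat]
    simp

theorem cc_curry_nat [HasBinaryProducts V] (cc : CartClosed V) {W W' Y B : V} (a : W ⟶ W')
    (f : W' ⨯ Y ⟶ B) : a ≫ cc.curry f = cc.curry (prod.map a (𝟙 Y) ≫ f) :=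
  ((cc.adj Y).homEquiv_naturality_left a f).symm

theorem l_curry_nat (L : LeftClosed V) {X A A' B : V} (a : A ⟶ A')
    (f : X ⊗ A' ⟶ B) : a ≫ L.curry f = L.curry ((X ◁ a) ≫ f) :=
  ((L.adj X).homEquiv_naturality_left a f).symm

theorem cc_ev_inj [HasBinaryProducts V] (cc : CartClosed V) {W Y B : V} (a b : W ⟶ cc.ch Y B)
    (h : prod.map a (𝟙 Y) ≫ cc.ev Y B = prod.map b (𝟙 Y) ≫ cc.ev Y B) : a = b := by
  exact ((cc.adj Y).homEquiv W B).symm.injective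
    (((cc.adj Y).homEquiv_counit _ _ _).trans (Eq.trans h ((cc.adj Y).homEquiv_counit _ _ _).symm))

theorem l_ev_inj (L : LeftClosed V) {X A B : V} (a b : A ⟶ L.hl X B)
    (h : (X ◁ a) ≫ L.ev X B = (X ◁ b) ≫ L.ev X B) : a = b := by
  exact ((L.adj X).homEquiv A B).symm.injective
    (((L.adj X).homEquiv_counit _ _ _).trans (Eq.trans h ((L.adj X).homEquiv_counit _ _ _).symm))

/-- Let `V` be a monoidal category with projections, cartesian closed,
with biclosed monoidal structure, and suppose `V` has jointly surjective projections.
Then the canonical morphism `λ : Homₗ(X, Hom(Y, Z)) ⟶ Hom(Y, Homₗ(X, Z))` is a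
monomorphism. -/
theorem lam_mono [HasFiniteProducts V] (hI : IsTerminal (𝟙_ V))
    (R : RightClosed V) (L : LeftClosed V) (cc : CartClosed V)
    (hepi : ∀ X Y : V, Epi (piMap hI X Y)) (X Y Z : V) :
    Mono (lam hI L cc X Y Z) := by
  constructor
  intro W a b h
  have key : ∀ c : W ⟶ L.hl X (cc.ch Y Z), c ≫ lam hI L cc X Y Z =
      cc.curry (L.curry (phi hI X W Y ≫
        prod.map ((X ◁ c) ≫ L.ev X (cc.ch Y Z)) (𝟙 Y) ≫ cc.ev Y Z)) := by
    intro c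
    rw [lam, cc_curry_nat, l_curry_nat, ← Category.assoc (X ◁ _), phi_nat]
    simp only [Category.assoc, prod.map_map_assoc, Category.comp_id]
  rw [key, key] at h
  have h2 := ((L.adj X).homEquiv _ _).injective (((cc.adj Y).homEquiv _ _).injective h)
  have := phi_epi hI hepi X W Y
  exact l_ev_inj L a b (cc_ev_inj cc _ _ ((cancel_epi (phi hI X W Y)).1 h2))

end PaperComma

end
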